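/- Let Q = (I,H) be a finite quiver with source and target maps out, inc : H → I, and let integers m_h, m_{h*} be given for each h ∈ H. Fix dimension vectors v₁, v₂, w₁, w₂ ∈ ℕ^I. Work in the fraction field of the polynomial ring over ℂ in t₁, t₂, the variables λ^i_s (i ∈ I, 1 ≤ s ≤ v₁^i + v₂^i) and z^j_t (j ∈ I, 1 ≤ t ≤ w₁^j + w₂^j). Let fac = fac₁·fac₂, where fac₁ = ∏_{i∈I}∏_{s=1}^{v₁^i}∏_{t=1}^{v₂^i} (λ'^i_s − λ''^i_t + t₁ + t₂)/(λ''^i_t − λ'^i_s) and fac₂ = ∏_{h∈H}[∏_{s=1}^{v₁^{out(h)}}∏_{t=1}^{v₂^{inc(h)}} (λ''^{inc(h)}_t − λ'^{out(h)}_s + m_h t₁)·∏_{s=1}^{v₁^{inc(h)}}∏_{t=1}^{v₂^{out(h)}} (λ''^{out(h)}_t − λ'^{inc(h)}_s + m_{h*} t₂)] · ∏_{i∈I}[∏_{s=1}^{v₁^i}∏_{t=1}^{w₂^i} (z''^i_t − λ'^i_s + t₁)·∏_{s=1}^{w₁^i}∏_{t=1}^{v₂^i} (λ''^i_t − z'^i_s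 + t₂)], with primed variables denoting the first v₁ (resp. w₁) variables of each color in positions determined by the shuffle and double-primed the remaining ones. Then for any polynomial f in t₁,t₂ and the variables (λ'^i_s, z'^j_t), symmetric in the λ'-variables of each color and in the z'-variables of each color, and any polynomial g likewise symmetric in the λ''- and z''-variables, the shuffle sum Σ_{σ ∈ ∏_i Sh(v₁^i,v₂^i) × ∏_j Sh(w₁^j,w₂^j)} σ(f·g·fac) is a polynomial (all apparent poles cancel) and is symmetric in the λ-variables of each color and in the z-variables of each color. -/

import Mathlib

open scoped Classical
open MvPolynomial

noncomputable section

/-- An `(n,m)`-shuffle: a permutation of `{1,…,n+m}` strictly increasing on the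
first block `{1,…,n}` and on the second block `{n+1,…,n+m}`. -/
def IsShuffle (n m : ℕ) (τ : Equiv.Perm (Fin (n + m))) : Prop :=
  StrictMono (fun i : Fin n => τ (Fin.castAdd m i)) ∧
  StrictMono (fun j : Fin m => τ (Fin.natAdd n j))

/-- The set of variables `t₁, t₂`, `λ^i_s` (`i ∈ I`, `1 ≤ s ≤ v(i)`) and
`z^j_t` (`j ∈ I`, `1 ≤ t ≤ w(j)`). -/
abbrev QVar (I : Type) (v w : I → ℕ) : Type :=
  Fin 2 ⊕ ((Σ i : I, Fin (v i)) ⊕ (Σ j : I, Fin (w j)))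

variable {I : Type}

def t1Var {v w : I → ℕ} : QVar I v w := Sum.inl 0
def t2Var {v w : I → ℕ} : QVar I v w := Sum.inl 1
def lamVar {v w : I → ℕ} (i : I) (s : Fin (v i)) : QVar I v w := Sum.inr (Sum.inl ⟨i, s⟩)
def zVar {v w : I → ℕ} (j : I) (t : Fin (w j)) : QVar I v w := Sum.inr (Sum.inr ⟨j, t⟩)

/-- Relabel the `λ`- and `z`-variables colorwise, leaving `t₁, t₂` fixed. -/
def renameColors {v w v' w' : I → ℕ}
    (fl : ∀ i, Fin (v i) → Fin (v' i)) (fz : ∀ j, Fin (w j) → Fin (w' j)) :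
    QVar I v w → QVar I v' w'
  | Sum.inl t => Sum.inl t
  | Sum.inr (Sum.inl ⟨i, s⟩) => Sum.inr (Sum.inl ⟨i, fl i s⟩)
  | Sum.inr (Sum.inr ⟨j, t⟩) => Sum.inr (Sum.inr ⟨j, fz j t⟩)

/-- A polynomial is symmetric in the `λ`-variables of each color and in the
`z`-variables of each color. -/
def IsSym (v w : I → ℕ) (p : MvPolynomial (QVar I v w) ℂ) : Prop :=
  ∀ (ρ : ∀ i, Equiv.Perm (Fin (v i))) (π : ∀ j, Equiv.Perm (Fin (w j))),
    rename (renameColors (fun i s => ρ i s) (fun j t => π j t)) p = p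

/-- The canonical map into the fraction field. -/
def embQ (v w : I → ℕ) :
    MvPolynomial (QVar I v w) ℂ →+* FractionRing (MvPolynomial (QVar I v w) ℂ) :=
  algebraMap _ _

/-- A tuple of shuffles, one for each `λ`-color and one for each `z`-color. -/
abbrev ShufflePair (v₁ v₂ w₁ w₂ : I → ℕ) : Type :=
  ((i : I) → Equiv.Perm (Fin (v₁ i + v₂ i))) × ((j : I) → Equiv.Perm (Fin (w₁ j + w₂ j)))

def IsShufflePair {v₁ v₂ w₁ w₂ : I → ℕ} (σ : ShufflePair v₁ v₂ w₁ w₂) : Prop :=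
  (∀ i, IsShuffle (v₁ i) (v₂ i) (σ.1 i)) ∧ ∀ j, IsShuffle (w₁ j) (w₂ j) (σ.2 j)

/-- Position of the `s`-th primed `λ`-variable of color `i` under the shuffle `σ`. -/
def lamP {v₁ v₂ w₁ w₂ : I → ℕ} (σ : ShufflePair v₁ v₂ w₁ w₂) (i : I) (s : Fin (v₁ i)) :
    Fin ((fun i => v₁ i + v₂ i) i) := σ.1 i (Fin.castAdd (v₂ i) s)

/-- Position of the `t`-th double-primed `λ`-variable of color `i` under the shuffle `σ`. -/
def lamPP {v₁ v₂ w₁ w₂ : I → ℕ} (σ : ShufflePair v₁ v₂ w₁ w₂) (i : I) (t : Fin (v₂ i)) :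
    Fin ((fun i => v₁ i + v₂ i) i) := σ.1 i (Fin.natAdd (v₁ i) t)

/-- Position of the `s`-th primed `z`-variable of color `j` under the shuffle `σ`. -/
def zP {v₁ v₂ w₁ w₂ : I → ℕ} (σ : ShufflePair v₁ v₂ w₁ w₂) (j : I) (s : Fin (w₁ j)) :
    Fin ((fun j => w₁ j + w₂ j) j) := σ.2 j (Fin.castAdd (w₂ j) s)

/-- Position of the `t`-th double-primed `z`-variable of color `j` under the shuffle `σ`. -/
def zPP {v₁ v₂ w₁ w₂ : I → ℕ} (σ : ShufflePair v₁ v₂ w₁ w₂) (j : I) (t : Fin (w₂ j)) :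
    Fin ((fun j => w₁ j + w₂ j) j) := σ.2 j (Fin.natAdd (w₁ j) t)

/-- The factor `fac = fac₁ ⋅ fac₂` of the framed shuffle algebra of the quiver
with arrow set `H`, sources `hout`, targets `hinc` and weights `mh, mhs`, in the
variable positions determined by the shuffle `σ`. -/
def facQ {H : Type} [Fintype I] [Fintype H]
    (hout hinc : H → I) (mh mhs : H → ℤ) {v₁ v₂ w₁ w₂ : I → ℕ}
    (σ : ShufflePair v₁ v₂ w₁ w₂) :
    FractionRing (MvPolynomial (QVar I (fun i => v₁ i + v₂ i) (fun j => w₁ j + w₂ j)) ℂ) :=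
  let e := embQ (I := I) (fun i => v₁ i + v₂ i) (fun j => w₁ j + w₂ j)
  -- fac₁
  (∏ i : I, ∏ s : Fin (v₁ i), ∏ t : Fin (v₂ i),
    e (X (lamVar i (lamP σ i s)) - X (lamVar i (lamPP σ i t)) + X t1Var + X t2Var) /
    e (X (lamVar i (lamPP σ i t)) - X (lamVar i (lamP σ i s)))) *
  -- fac₂
  ((∏ h : H,
      (∏ s : Fin (v₁ (hout h)), ∏ t : Fin (v₂ (hinc h)),
        e (X (lamVar (hinc h) (lamPP σ (hinc h) t)) - X (lamVar (hout h) (lamP σ (hout h) s)) +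
          C (mh h : ℂ) * X t1Var)) *
      (∏ s : Fin (v₁ (hinc h)), ∏ t : Fin (v₂ (hout h)),
        e (X (lamVar (hout h) (lamPP σ (hout h) t)) - X (lamVar (hinc h) (lamP σ (hinc h) s)) +
          C (mhs h : ℂ) * X t2Var))) *
    (∏ i : I,
      (∏ s : Fin (v₁ i), ∏ t : Fin (w₂ i),
        e (X (zVar i (zPP σ i t)) - X (lamVar i (lamP σ i s)) + X t1Var)) *
      (∏ s : Fin (w₁ i), ∏ t : Fin (v₂ i),
        e (X (lamVar i (lamPP σ i t)) - X (zVar i (zP σ i s)) + X t2Var))))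

/-- The framed shuffle-product sum `Σ_σ σ(f · g · fac)` computed in the fraction field. -/
def hallSum {H : Type} [Fintype I] [DecidableEq I] [Fintype H]
    (hout hinc : H → I) (mh mhs : H → ℤ) {v₁ v₂ w₁ w₂ : I → ℕ}
    (f : MvPolynomial (QVar I v₁ w₁) ℂ) (g : MvPolynomial (QVar I v₂ w₂) ℂ) :
    FractionRing (MvPolynomial (QVar I (fun i => v₁ i + v₂ i) (fun j => w₁ j + w₂ j)) ℂ) :=
  ∑ σ ∈ Finset.univ.filter (fun σ : ShufflePair v₁ v₂ w₁ w₂ => IsShufflePair σ),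
    embQ _ _ (rename (renameColors (lamP σ) (zP σ)) f) *
    embQ _ _ (rename (renameColors (lamPP σ) (zPP σ)) g) *
    facQ hout hinc mh mhs σ

section LinearForms

variable {V : Type*}

lemma irreducible_X_sub_X {x y : V} (h : x ≠ y) :
    Irreducible (X x - X y : MvPolynomial V ℂ) := by
  have := irreducible_mul_X_add (1 : MvPolynomial V ℂ) (-X y) x one_ne_zero
    (by simp) (by simpa [vars_neg] using h) isRelPrime_one_left
  simpa [sub_eq_add_neg] using this

lemma eq_or_eq_swap_of_X_sub_X_dvd {x y x' y' : V} (h' : x' ≠ y')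
    (hd : (X x - X y : MvPolynomial V ℂ) ∣ X x' - X y') :
    (x' = x ∧ y' = y) ∨ (x' = y ∧ y' = x) := by
  have key : ∀ u : V, u ≠ x → u ≠ y → u ≠ x' ∧ u ≠ y' := by
    intro u hx hy
    have := map_dvd (eval (Pi.single u (1 : ℂ))) hd
    simp only [map_sub, eval_X, Pi.single_apply, if_neg hx.symm, if_neg hy.symm, sub_zero,
      zero_dvd_iff] at this
    refine ⟨?_, ?_⟩ <;> rintro rfl
    · simp [h'.symm] at this
    · simp [h'] at this
  have h1 := key x'
  have h2 := key y'
  grind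

lemma X_sub_X_dvd_sub_rename_swap [DecidableEq V] (x y : V) (p : MvPolynomial V ℂ) :
    (X x - X y) ∣ p - rename (Equiv.swap x y) p := by
  rw [← Ideal.mem_span_singleton, ← Ideal.Quotient.mk_eq_mk_iff_sub_mem]
  set J : Ideal (MvPolynomial V ℂ) := Ideal.span {X x - X y} with hJ
  have hxy : Ideal.Quotient.mkₐ ℂ J (X x) = Ideal.Quotient.mkₐ ℂ J (X y) :=
    Ideal.Quotient.eq.2 (Ideal.mem_span_singleton_self _)
  have : Ideal.Quotient.mkₐ ℂ J = (Ideal.Quotient.mkₐ ℂ J).comp (rename (Equiv.swap x y)) := by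
    refine algHom_ext fun u => ?_
    simp only [AlgHom.comp_apply, rename_X]
    by_cases hx : u = x
    · subst hx; simpa using hxy
    by_cases hy : u = y
    · subst hy; simpa using hxy.symm
    rw [Equiv.swap_apply_of_ne_of_ne hx hy]
  exact DFunLike.congr_fun this p

lemma X_sub_X_dvd_of_rename_swap_eq_neg [DecidableEq V] {x y : V} {p : MvPolynomial V ℂ}
    (hp : rename (Equiv.swap x y) p = -p) : (X x - X y) ∣ p := by
  have h := X_sub_X_dvd_sub_rename_swap x y p
  have h2 := h.mul_left (C (1 / 2 : ℂ))
  rw [hp, sub_neg_eq_add, ← two_mul, ← mul_assoc] at h2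
  have : (C (1 / 2 : ℂ) * 2 : MvPolynomial V ℂ) = 1 := by
    rw [show (2 : MvPolynomial V ℂ) = C 2 from (map_ofNat C 2).symm, ← C_mul]; norm_num
  rwa [this, one_mul] at h2

end LinearForms

section ColorAction

variable {v w : I → ℕ}

/-- Colorwise permutations of the variables. -/
abbrev ColorPerm (v w : I → ℕ) : Type :=
  ((i : I) → Equiv.Perm (Fin (v i))) × ((j : I) → Equiv.Perm (Fin (w j)))

/-- The action of colorwise permutations on polynomials. -/
def colorAct (σ : ColorPerm v w) :
    MvPolynomial (QVar I v w) ℂ →ₐ[ℂ] MvPolynomial (QVar I v w) ℂ :=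
  rename (renameColors (fun i s => σ.1 i s) (fun j t => σ.2 j t))

lemma renameColors_comp {v w v' w' v'' w'' : I → ℕ}
    (fl : ∀ i, Fin (v i) → Fin (v' i)) (fz : ∀ j, Fin (w j) → Fin (w' j))
    (gl : ∀ i, Fin (v' i) → Fin (v'' i)) (gz : ∀ j, Fin (w' j) → Fin (w'' j)) :
    renameColors gl gz ∘ renameColors fl fz =
      renameColors (fun i s => gl i (fl i s)) (fun j t => gz j (fz j t)) := by
  funext x
  rcases x with x | ⟨i, s⟩ | ⟨j, t⟩ <;> rfl

lemma colorAct_mul (τ σ : ColorPerm v w) (p : MvPolynomial (QVar I v w) ℂ) :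
    colorAct (τ * σ) p = colorAct τ (colorAct σ p) := by
  simp only [colorAct, rename_rename, renameColors_comp]
  rfl

lemma colorAct_lam (σ : ColorPerm v w) (i : I) (s : Fin (v i)) :
    colorAct σ (X (lamVar i s)) = X (lamVar i (σ.1 i s)) := rename_X _ _

lemma colorAct_z (σ : ColorPerm v w) (j : I) (t : Fin (w j)) :
    colorAct σ (X (zVar j t)) = X (zVar j (σ.2 j t)) := rename_X _ _

lemma colorAct_t1 (σ : ColorPerm v w) : colorAct σ (X t1Var) = X t1Var := rename_X _ _

lemma colorAct_t2 (σ : ColorPerm v w) : colorAct σ (X t2Var) = X t2Var := rename_X _ _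

lemma lamVar_injective (i : I) :
    Function.Injective (lamVar i : Fin (v i) → QVar I v w) := by
  intro a b h
  simpa [lamVar] using h

lemma colorAct_mulSingle_swap [DecidableEq I] (i : I) (a b : Fin (v i))
    (p : MvPolynomial (QVar I v w) ℂ) :
    colorAct (Pi.mulSingle i (Equiv.swap a b), 1) p =
      rename (Equiv.swap (lamVar i a) (lamVar i b)) p := by
  unfold colorAct
  congr 2
  funext x
  rcases x with x | ⟨j, s⟩ | ⟨j, t⟩
  · rw [Equiv.swap_apply_of_ne_of_ne] <;> simp [lamVar, renameColors]
  · change lamVar j _ = Equiv.swap _ _ (lamVar j s)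
    by_cases h : j = i
    · subst h
      rw [(lamVar_injective j).swap_apply]
      simp
    · rw [Equiv.swap_apply_of_ne_of_ne]
      · simp [Pi.mulSingle_eq_of_ne h]
      all_goals
        simp only [lamVar, ne_eq, Sum.inr.injEq, Sum.inl.injEq]
        intro e
        exact h (congrArg Sigma.fst e)
  · rw [Equiv.swap_apply_of_ne_of_ne] <;> simp [lamVar, renameColors]

variable [Fintype I]

/-- The product of the Vandermonde determinants of the `λ`-variables of each color. -/
def colorVandermonde (v w : I → ℕ) : MvPolynomial (QVar I v w) ℂ :=
  ∏ i : I, ∏ a : Fin (v i), ∏ b ∈ Finset.Ioi a, (X (lamVar i b) - X (lamVar i a))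

/-- The sign of a colorwise permutation of the `λ`-variables. -/
def colorSign (σ : ColorPerm v w) : ℤˣ := ∏ i : I, Equiv.Perm.sign (σ.1 i)

lemma colorSign_mul (τ σ : ColorPerm v w) :
    colorSign (τ * σ) = colorSign τ * colorSign σ := by
  simp [colorSign, Finset.prod_mul_distrib]

lemma colorSign_mulSingle_swap [DecidableEq I] (i : I) {a b : Fin (v i)} (h : a ≠ b) :
    colorSign ((Pi.mulSingle i (Equiv.swap a b), 1) : ColorPerm v w) = -1 := by
  unfold colorSign
  rw [Finset.prod_eq_single i]
  · simp [Equiv.Perm.sign_swap h]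
  · intro j _ hj
    simp [Pi.mulSingle_eq_of_ne hj]
  · simp

lemma colorSign_mul_self (σ : ColorPerm v w) :
    (((colorSign σ : ℤˣ) : ℤ) : MvPolynomial (QVar I v w) ℂ) *
      (((colorSign σ : ℤˣ) : ℤ) : MvPolynomial (QVar I v w) ℂ) = 1 := by
  rw [← Int.cast_mul, ← Units.val_mul, Int.units_mul_self]
  simp

lemma colorAct_colorVandermonde (σ : ColorPerm v w) :
    colorAct σ (colorVandermonde v w) = ((colorSign σ : ℤˣ) : ℤ) * colorVandermonde v w := by
  unfold colorVandermonde colorSign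
  simp only [map_prod, map_sub, colorAct_lam, Units.coe_prod, Int.cast_prod,
    ← Finset.prod_mul_distrib]
  refine Finset.prod_congr rfl fun i _ => ?_
  rw [← Matrix.det_vandermonde (fun a : Fin (v i) => (X (lamVar i a) : MvPolynomial (QVar I v w) ℂ)),
    ← Matrix.det_permute, ← Matrix.det_vandermonde
      (fun a : Fin (v i) => (X (lamVar i (σ.1 i a)) : MvPolynomial (QVar I v w) ℂ))]
  rfl

lemma colorVandermonde_ne_zero : colorVandermonde v w ≠ 0 := by
  unfold colorVandermonde
  simp only [ne_eq, Finset.prod_eq_zero_iff, not_exists, not_and, Finset.mem_Ioi, sub_eq_zero]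
  intro i _ a _ b hab h
  exact hab.ne' (lamVar_injective i (X_injective h))

lemma colorVandermonde_dvd {p : MvPolynomial (QVar I v w) ℂ}
    (hp : ∀ σ : ColorPerm v w, colorAct σ p = ((colorSign σ : ℤˣ) : ℤ) * p) :
    colorVandermonde v w ∣ p := by
  unfold colorVandermonde
  simp only [Finset.prod_sigma']
  refine Finset.prod_dvd_of_isRelPrime ?_ ?_
  · rintro ⟨i, a, b⟩ h1 ⟨j, c, d⟩ h2 hne
    simp only [Finset.coe_sigma, Set.mem_sigma_iff, Finset.mem_coe, Finset.mem_univ,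
      Finset.mem_Ioi, true_and] at h1 h2
    refine (irreducible_X_sub_X ((lamVar_injective i).ne h1.ne')).isRelPrime_iff_not_dvd.2 ?_
    intro hd
    apply hne
    rcases eq_or_eq_swap_of_X_sub_X_dvd ((lamVar_injective j).ne h2.ne') hd with ⟨e1, e2⟩ | ⟨e1, e2⟩
    all_goals
      simp only [lamVar, Sum.inr.injEq, Sum.inl.injEq, Sigma.mk.injEq] at e1 e2
      obtain ⟨rfl, e1⟩ := e1
      obtain ⟨-, e2⟩ := e2
      obtain rfl := eq_of_heq e1
      obtain rfl := eq_of_heq e2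
    · rfl
    · exact absurd h1 h2.asymm
  · rintro ⟨i, a, b⟩ h
    simp only [Finset.mem_sigma, Finset.mem_univ, Finset.mem_Ioi, true_and] at h
    refine X_sub_X_dvd_of_rename_swap_eq_neg ?_
    change rename (Equiv.swap (lamVar i b) (lamVar i a)) p = -p
    rw [← colorAct_mulSingle_swap, hp, colorSign_mulSingle_swap i h.ne']
    simp

/-- The antisymmetrization of a polynomial over all colorwise permutations is the product of the
Vandermonde determinants with a colorwise-symmetric polynomial. -/
lemma exists_isSym_mul_colorVandermonde [DecidableEq I] (p : MvPolynomial (QVar I v w) ℂ) :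
    ∃ q, IsSym v w q ∧ colorVandermonde v w * q =
      ∑ σ : ColorPerm v w, ((colorSign σ : ℤˣ) : ℤ) * colorAct σ p := by
  set P := ∑ σ : ColorPerm v w, (((colorSign σ : ℤˣ) : ℤ) : MvPolynomial (QVar I v w) ℂ) *
    colorAct σ p with hP
  have hPact : ∀ τ : ColorPerm v w, colorAct τ P = ((colorSign τ : ℤˣ) : ℤ) * P := by
    intro τ
    rw [hP, map_sum, Finset.mul_sum]
    refine Fintype.sum_equiv (Equiv.mulLeft τ) _ _ fun σ => ?_
    simp only [Equiv.coe_mulLeft, colorSign_mul, colorAct_mul, map_mul, map_intCast,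
      Units.val_mul, Int.cast_mul, ← mul_assoc, colorSign_mul_self, one_mul]
  obtain ⟨q, hq⟩ := colorVandermonde_dvd hPact
  refine ⟨q, fun ρ π => ?_, hq.symm⟩
  have h := hPact (ρ, π)
  have hs := colorSign_mul_self (v := v) (w := w) (ρ, π)
  rw [hq, map_mul, colorAct_colorVandermonde, mul_assoc] at h
  have hu : (((colorSign ((ρ, π) : ColorPerm v w) : ℤˣ) : ℤ) : MvPolynomial (QVar I v w) ℂ) ≠ 0 :=
    left_ne_zero_of_mul_eq_one hs
  exact mul_left_cancel₀ colorVandermonde_ne_zero (mul_left_cancel₀ hu h)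

end ColorAction

section Young

/-- The block permutation of `{1,…,n+m}` given by permutations of the two blocks. -/
def blockPerm (n m : ℕ) : Equiv.Perm (Fin n) × Equiv.Perm (Fin m) →* Equiv.Perm (Fin (n + m)) :=
  (finSumFinEquiv.permCongrHom.toMonoidHom).comp (Equiv.Perm.sumCongrHom (Fin n) (Fin m))

lemma blockPerm_castAdd {n m : ℕ} (κ : Equiv.Perm (Fin n) × Equiv.Perm (Fin m)) (s : Fin n) :
    blockPerm n m κ (Fin.castAdd m s) = Fin.castAdd m (κ.1 s) := by
  simp [blockPerm, Equiv.permCongrHom]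

lemma blockPerm_natAdd {n m : ℕ} (κ : Equiv.Perm (Fin n) × Equiv.Perm (Fin m)) (t : Fin m) :
    blockPerm n m κ (Fin.natAdd n t) = Fin.natAdd n (κ.2 t) := by
  simp [blockPerm, Equiv.permCongrHom]

lemma IsShuffle.eq_one_of_mul_blockPerm {n m : ℕ} {τ : Equiv.Perm (Fin (n + m))}
    {κ : Equiv.Perm (Fin n) × Equiv.Perm (Fin m)} (hτ : IsShuffle n m τ)
    (h : IsShuffle n m (τ * blockPerm n m κ)) : κ = 1 := by
  obtain ⟨h1, h2⟩ := h
  simp only [Equiv.Perm.mul_apply, blockPerm_castAdd, blockPerm_natAdd] at h1 h2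
  have e1 := (h1.range_inj hτ.1).1
    (κ.1.surjective.range_comp fun s => τ (Fin.castAdd m s))
  have e2 := (h2.range_inj hτ.2).1
    (κ.2.surjective.range_comp fun t => τ (Fin.natAdd n t))
  refine Prod.ext (Equiv.ext fun s => ?_) (Equiv.ext fun t => ?_)
  · exact hτ.1.injective (congrFun e1 s)
  · exact hτ.2.injective (congrFun e2 t)

lemma exists_isShuffle_mul_blockPerm {n m : ℕ} (τ : Equiv.Perm (Fin (n + m))) :
    ∃ κ, IsShuffle n m (τ * blockPerm n m κ) := by
  refine ⟨(Tuple.sort fun s => τ (Fin.castAdd m s), Tuple.sort fun t => τ (Fin.natAdd n t)),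
    ?_, ?_⟩
  · simp only [Equiv.Perm.mul_apply, blockPerm_castAdd]
    exact (Tuple.monotone_sort fun s => τ (Fin.castAdd m s)).strictMono_of_injective
      ((τ.injective.comp (Fin.castAdd_injective n m)).comp (Equiv.injective _))
  · simp only [Equiv.Perm.mul_apply, blockPerm_natAdd]
    exact (Tuple.monotone_sort fun t => τ (Fin.natAdd n t)).strictMono_of_injective
      ((τ.injective.comp (Fin.natAdd_injective m n)).comp (Equiv.injective _))

variable {v₁ v₂ w₁ w₂ : I → ℕ}

/-- Tuples of permutations preserving the two blocks of each color. -/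
abbrev Young (v₁ v₂ w₁ w₂ : I → ℕ) : Type :=
  ((i : I) → Equiv.Perm (Fin (v₁ i)) × Equiv.Perm (Fin (v₂ i))) ×
    ((j : I) → Equiv.Perm (Fin (w₁ j)) × Equiv.Perm (Fin (w₂ j)))

/-- The inclusion of the Young subgroup into the group of colorwise permutations. -/
def youngPerm : Young v₁ v₂ w₁ w₂ →* ShufflePair v₁ v₂ w₁ w₂ where
  toFun κ := (fun i => blockPerm _ _ (κ.1 i), fun j => blockPerm _ _ (κ.2 j))
  map_one' := by ext <;> simp
  map_mul' κ κ' := by ext <;> simp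

/-- A sum over all colorwise permutations of a function invariant under the Young subgroup is a
multiple of the sum over the shuffles. -/
lemma sum_eq_card_mul_sum_isShufflePair [Fintype I] [DecidableEq I] {K : Type*} [Ring K]
    (T : ShufflePair v₁ v₂ w₁ w₂ → K) (hT : ∀ σ κ, T (σ * youngPerm κ) = T σ) :
    ∑ σ, T σ = Fintype.card (Young v₁ v₂ w₁ w₂) *
      ∑ σ ∈ Finset.univ.filter (fun σ : ShufflePair v₁ v₂ w₁ w₂ => IsShufflePair σ), T σ := by
  have : ∑ x ∈ (Finset.univ.filter
        (fun σ : ShufflePair v₁ v₂ w₁ w₂ => IsShufflePair σ)) ×ˢ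
        (Finset.univ : Finset (Young v₁ v₂ w₁ w₂)), T x.1 = ∑ σ, T σ := by
    refine Finset.sum_bij (fun x _ => x.1 * youngPerm x.2) (by simp) ?_ ?_ ?_
    · rintro ⟨σ, κ⟩ h ⟨σ', κ'⟩ h' e
      simp only [Finset.mem_product, Finset.mem_filter, Finset.mem_univ, true_and,
        and_true] at h h'
      have e' : σ' = σ * youngPerm (κ * κ'⁻¹) := by
        rw [map_mul, map_inv, ← mul_assoc]
        exact eq_mul_inv_of_mul_eq e.symm
      subst e'
      have hκ : κ * κ'⁻¹ = 1 := Prod.ext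
        (funext fun i => (h.1 i).eq_one_of_mul_blockPerm (h'.1 i))
        (funext fun j => (h.2 j).eq_one_of_mul_blockPerm (h'.2 j))
      rw [hκ, map_one, mul_one, mul_inv_eq_one.1 hκ]
    · intro σ _
      choose κ hκ using fun i => exists_isShuffle_mul_blockPerm (σ.1 i)
      choose μ hμ using fun j => exists_isShuffle_mul_blockPerm (σ.2 j)
      refine ⟨(σ * youngPerm (κ, μ), (κ, μ)⁻¹), ?_, ?_⟩
      · simp only [Finset.mem_product, Finset.mem_filter, Finset.mem_univ, true_and, and_true]
        exact ⟨hκ, hμ⟩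
      · simp only [map_inv, mul_inv_cancel_right]
    · intro x _
      exact (hT _ _).symm
  rw [← this, Finset.sum_product_right]
  simp [nsmul_eq_mul]

end Young

section Factor

variable {v₁ v₂ w₁ w₂ : I → ℕ}

lemma prod_prod_eq_of_perm {K : Type*} [CommMonoid K] {α β : Type*} [Fintype α] [Fintype β]
    {F' F : α → β → K} (ρ : Equiv.Perm α) (π : Equiv.Perm β)
    (h : ∀ s t, F' s t = F (ρ s) (π t)) : ∏ s, ∏ t, F' s t = ∏ s, ∏ t, F s t :=
  Fintype.prod_equiv ρ _ _ fun s => Fintype.prod_equiv π _ _ fun t => h s t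

lemma mul_mul_eq_mul_mul_div_of_ne_zero {K : Type*} [Field K] (ε a b n r : K) {d : K} (hd : d ≠ 0) :
    ε * (a * b * n * r) = ε * (d * r) * (a * b * (n / d)) := by
  field_simp

section Positions

variable (σ : ShufflePair v₁ v₂ w₁ w₂) (κ : Young v₁ v₂ w₁ w₂)

lemma lamP_mul_youngPerm (i : I) (s : Fin (v₁ i)) :
    lamP (σ * youngPerm κ) i s = lamP σ i ((κ.1 i).1 s) :=
  congrArg (σ.1 i) (blockPerm_castAdd _ s)

lemma lamPP_mul_youngPerm (i : I) (t : Fin (v₂ i)) :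
    lamPP (σ * youngPerm κ) i t = lamPP σ i ((κ.1 i).2 t) :=
  congrArg (σ.1 i) (blockPerm_natAdd _ t)

lemma zP_mul_youngPerm (j : I) (s : Fin (w₁ j)) :
    zP (σ * youngPerm κ) j s = zP σ j ((κ.2 j).1 s) :=
  congrArg (σ.2 j) (blockPerm_castAdd _ s)

lemma zPP_mul_youngPerm (j : I) (t : Fin (w₂ j)) :
    zPP (σ * youngPerm κ) j t = zPP σ j ((κ.2 j).2 t) :=
  congrArg (σ.2 j) (blockPerm_natAdd _ t)

end Positions

variable [Fintype I] {H : Type} [Fintype H] (hout hinc : H → I) (mh mhs : H → ℤ)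

/-- The numerator of `facQ`. -/
def facNum (σ : ShufflePair v₁ v₂ w₁ w₂) :
    MvPolynomial (QVar I (fun i => v₁ i + v₂ i) (fun j => w₁ j + w₂ j)) ℂ :=
  (∏ i : I, ∏ s : Fin (v₁ i), ∏ t : Fin (v₂ i),
    (X (lamVar i (lamP σ i s)) - X (lamVar i (lamPP σ i t)) + X t1Var + X t2Var)) *
  ((∏ h : H,
      (∏ s : Fin (v₁ (hout h)), ∏ t : Fin (v₂ (hinc h)),
        (X (lamVar (hinc h) (lamPP σ (hinc h) t)) - X (lamVar (hout h) (lamP σ (hout h) s)) +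
          C (mh h : ℂ) * X t1Var)) *
      (∏ s : Fin (v₁ (hinc h)), ∏ t : Fin (v₂ (hout h)),
        (X (lamVar (hout h) (lamPP σ (hout h) t)) - X (lamVar (hinc h) (lamP σ (hinc h) s)) +
          C (mhs h : ℂ) * X t2Var))) *
    (∏ i : I,
      (∏ s : Fin (v₁ i), ∏ t : Fin (w₂ i),
        (X (zVar i (zPP σ i t)) - X (lamVar i (lamP σ i s)) + X t1Var)) *
      (∏ s : Fin (w₁ i), ∏ t : Fin (v₂ i),
        (X (lamVar i (lamPP σ i t)) - X (zVar i (zP σ i s)) + X t2Var))))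

/-- The denominator of `facQ`. -/
def facDen (σ : ShufflePair v₁ v₂ w₁ w₂) :
    MvPolynomial (QVar I (fun i => v₁ i + v₂ i) (fun j => w₁ j + w₂ j)) ℂ :=
  ∏ i : I, ∏ s : Fin (v₁ i), ∏ t : Fin (v₂ i),
    (X (lamVar i (lamPP σ i t)) - X (lamVar i (lamP σ i s)))

lemma facQ_eq_div (σ : ShufflePair v₁ v₂ w₁ w₂) :
    facQ hout hinc mh mhs σ =
      embQ _ _ (facNum hout hinc mh mhs σ) / embQ _ _ (facDen σ) := by
  simp only [facQ, facNum, facDen, map_mul, map_prod, Finset.prod_div_distrib]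
  exact div_mul_eq_mul_div _ _ _

lemma facNum_mul_youngPerm (σ : ShufflePair v₁ v₂ w₁ w₂) (κ : Young v₁ v₂ w₁ w₂) :
    facNum hout hinc mh mhs (σ * youngPerm κ) = facNum hout hinc mh mhs σ := by
  unfold facNum
  refine congrArg₂ (· * ·) (Finset.prod_congr rfl fun i _ => ?_)
    (congrArg₂ (· * ·) (Finset.prod_congr rfl fun h _ => congrArg₂ (· * ·) ?_ ?_)
      (Finset.prod_congr rfl fun i _ => congrArg₂ (· * ·) ?_ ?_))
  · refine prod_prod_eq_of_perm (κ.1 i).1 (κ.1 i).2 fun s t => ?_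
    rw [lamP_mul_youngPerm, lamPP_mul_youngPerm]
  · refine prod_prod_eq_of_perm (κ.1 (hout h)).1 (κ.1 (hinc h)).2 fun s t => ?_
    rw [lamP_mul_youngPerm, lamPP_mul_youngPerm]
  · refine prod_prod_eq_of_perm (κ.1 (hinc h)).1 (κ.1 (hout h)).2 fun s t => ?_
    rw [lamP_mul_youngPerm, lamPP_mul_youngPerm]
  · refine prod_prod_eq_of_perm (κ.1 i).1 (κ.2 i).2 fun s t => ?_
    rw [lamP_mul_youngPerm, zPP_mul_youngPerm]
  · refine prod_prod_eq_of_perm (κ.2 i).1 (κ.1 i).2 fun s t => ?_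
    rw [zP_mul_youngPerm, lamPP_mul_youngPerm]

lemma facDen_mul_youngPerm (σ : ShufflePair v₁ v₂ w₁ w₂) (κ : Young v₁ v₂ w₁ w₂) :
    facDen (σ * youngPerm κ) = facDen σ := by
  refine Finset.prod_congr rfl fun i _ => ?_
  refine prod_prod_eq_of_perm (κ.1 i).1 (κ.1 i).2 fun s t => ?_
  rw [lamP_mul_youngPerm, lamPP_mul_youngPerm]

lemma facQ_mul_youngPerm (σ : ShufflePair v₁ v₂ w₁ w₂) (κ : Young v₁ v₂ w₁ w₂) :
    facQ hout hinc mh mhs (σ * youngPerm κ) = facQ hout hinc mh mhs σ := by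
  rw [facQ_eq_div, facQ_eq_div, facNum_mul_youngPerm, facDen_mul_youngPerm]

lemma colorAct_facNum_one (σ : ShufflePair v₁ v₂ w₁ w₂) :
    colorAct σ (facNum hout hinc mh mhs 1) = facNum hout hinc mh mhs σ := by
  simp only [facNum, map_mul, map_prod, map_add, map_sub, colorAct_t1, colorAct_t2, colorAct_lam,
    colorAct_z, algHom_C, algebraMap_eq]
  rfl

lemma colorAct_facDen_one (σ : ShufflePair v₁ v₂ w₁ w₂) :
    colorAct σ (facDen (v₁ := v₁) (v₂ := v₂) (w₁ := w₁) (w₂ := w₂) 1) = facDen σ := by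
  simp only [facDen, map_prod, map_sub, colorAct_lam]
  rfl

lemma facDen_one_dvd_colorVandermonde :
    facDen (1 : ShufflePair v₁ v₂ w₁ w₂) ∣
      colorVandermonde (fun i => v₁ i + v₂ i) (fun j => w₁ j + w₂ j) := by
  unfold facDen colorVandermonde
  refine Finset.prod_dvd_prod_of_dvd _ _ fun i _ => ?_
  rw [Fin.prod_univ_add]
  refine Dvd.dvd.mul_right (Finset.prod_dvd_prod_of_dvd _ _ fun s _ => ?_) _
  have := Finset.prod_dvd_prod_of_subset
    (Finset.univ.map (Fin.natAddEmb (m := v₂ i) (v₁ i))) (Finset.Ioi (Fin.castAdd (v₂ i) s))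
    (fun b => (X (lamVar i b) - X (lamVar i (Fin.castAdd (v₂ i) s)) :
      MvPolynomial (QVar I (fun i => v₁ i + v₂ i) (fun j => w₁ j + w₂ j)) ℂ)) (by
      intro b hb
      obtain ⟨t, -, rfl⟩ := Finset.mem_map.1 hb
      simp only [Finset.mem_Ioi, Fin.lt_def]
      simp
      omega)
  rw [Finset.prod_map] at this
  exact this

end Factor

/-- The shuffle product of two colorwise-symmetric polynomials is again a
colorwise-symmetric polynomial: all apparent poles cancel. -/
theorem framed_shuffle_polynomial_and_symmetric [Fintype I] [DecidableEq I]
    {H : Type} [Fintype H] (hout hinc : H → I) (mh mhs : H → ℤ)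
    (v₁ v₂ w₁ w₂ : I → ℕ)
    (f : MvPolynomial (QVar I v₁ w₁) ℂ) (g : MvPolynomial (QVar I v₂ w₂) ℂ)
    (hf : IsSym v₁ w₁ f) (hg : IsSym v₂ w₂ g) :
    ∃ p : MvPolynomial (QVar I (fun i => v₁ i + v₂ i) (fun j => w₁ j + w₂ j)) ℂ,
      IsSym (fun i => v₁ i + v₂ i) (fun j => w₁ j + w₂ j) p ∧
      embQ _ _ p = hallSum hout hinc mh mhs f g := by
  set v : I → ℕ := fun i => v₁ i + v₂ i
  set w : I → ℕ := fun j => w₁ j + w₂ j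
  let T : ShufflePair v₁ v₂ w₁ w₂ → FractionRing (MvPolynomial (QVar I v w) ℂ) := fun σ =>
    embQ _ _ (rename (renameColors (lamP σ) (zP σ)) f) *
    embQ _ _ (rename (renameColors (lamPP σ) (zPP σ)) g) *
    facQ hout hinc mh mhs σ
  have hT : ∀ σ κ, T (σ * youngPerm κ) = T σ := by
    intro σ κ
    have h1 : rename (renameColors (lamP (σ * youngPerm κ)) (zP (σ * youngPerm κ))) f =
        rename (renameColors (lamP σ) (zP σ)) f := by
      conv_rhs => rw [← hf (fun i => (κ.1 i).1) (fun j => (κ.2 j).1), rename_rename,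
        renameColors_comp]
      simp only [← lamP_mul_youngPerm, ← zP_mul_youngPerm]
    have h2 : rename (renameColors (lamPP (σ * youngPerm κ)) (zPP (σ * youngPerm κ))) g =
        rename (renameColors (lamPP σ) (zPP σ)) g := by
      conv_rhs => rw [← hg (fun i => (κ.1 i).2) (fun j => (κ.2 j).2), rename_rename,
        renameColors_comp]
      simp only [← lamPP_mul_youngPerm, ← zPP_mul_youngPerm]
    simp only [T, h1, h2, facQ_mul_youngPerm]
  have hinj : Function.Injective (embQ v w) := IsFractionRing.injective _ _
  obtain ⟨r, hr⟩ := facDen_one_dvd_colorVandermonde (v₁ := v₁) (v₂ := v₂) (w₁ := w₁) (w₂ := w₂)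
  let p : MvPolynomial (QVar I v w) ℂ :=
    rename (renameColors (lamP (1 : ShufflePair v₁ v₂ w₁ w₂)) (zP (1 : ShufflePair v₁ v₂ w₁ w₂))) f *
    rename (renameColors (lamPP (1 : ShufflePair v₁ v₂ w₁ w₂)) (zPP (1 : ShufflePair v₁ v₂ w₁ w₂))) g *
    facNum hout hinc mh mhs 1 * r
  obtain ⟨q, hq, hqp⟩ := exists_isSym_mul_colorVandermonde p
  have hterm : ∀ σ : ShufflePair v₁ v₂ w₁ w₂,
      embQ v w (((colorSign σ : ℤˣ) : ℤ) * colorAct σ p) =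
        embQ v w (colorVandermonde v w) * T σ := by
    intro σ
    have hD : colorVandermonde v w =
        ((colorSign σ : ℤˣ) : ℤ) * (facDen σ * colorAct σ r) := by
      rw [← colorAct_facDen_one, ← map_mul, ← hr, colorAct_colorVandermonde, ← mul_assoc,
        colorSign_mul_self, one_mul]
    have hden : embQ v w (facDen σ) ≠ 0 := by
      rw [Ne, map_eq_zero_iff _ hinj]
      intro h0
      exact colorVandermonde_ne_zero (v := v) (w := w) (by rw [hD, h0]; simp)
    have hfσ : colorAct σ (rename (renameColors (lamP (1 : ShufflePair v₁ v₂ w₁ w₂))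
          (zP (1 : ShufflePair v₁ v₂ w₁ w₂))) f) =
        rename (renameColors (lamP σ) (zP σ)) f := by
      rw [colorAct, rename_rename, renameColors_comp]
      rfl
    have hgσ : colorAct σ
          (rename (renameColors (lamPP (1 : ShufflePair v₁ v₂ w₁ w₂)) (zPP (1 : ShufflePair v₁ v₂ w₁ w₂))) g) =
        rename (renameColors (lamPP σ) (zPP σ)) g := by
      rw [colorAct, rename_rename, renameColors_comp]
      rfl
    simp only [T, p]
    rw [hD, facQ_eq_div]
    simp only [map_mul, hfσ, hgσ, colorAct_facNum_one]
    exact mul_mul_eq_mul_mul_div_of_ne_zero _ _ _ _ _ hden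
  have hD0 : embQ v w (colorVandermonde v w) ≠ 0 := by
    rw [Ne, map_eq_zero_iff _ hinj]
    exact colorVandermonde_ne_zero
  have hsum : embQ v w q = Fintype.card (Young v₁ v₂ w₁ w₂) * hallSum hout hinc mh mhs f g := by
    rw [hallSum, ← sum_eq_card_mul_sum_isShufflePair T hT]
    refine mul_left_cancel₀ hD0 ?_
    rw [← map_mul, hqp, map_sum, Finset.mul_sum]
    exact Finset.sum_congr rfl fun σ _ => hterm σ
  have hcard : (Fintype.card (Young v₁ v₂ w₁ w₂) : ℂ) ≠ 0 :=
    Nat.cast_ne_zero.2 Fintype.card_ne_zero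
  refine ⟨C (Fintype.card (Young v₁ v₂ w₁ w₂) : ℂ)⁻¹ * q, fun ρ π => ?_, ?_⟩
  · rw [map_mul, rename_C, hq ρ π]
  · rw [map_mul, hsum, ← mul_assoc, ← map_natCast (embQ v w), ← map_mul, ← map_natCast C, ← C_mul,
      inv_mul_cancel₀ hcard, C_1, map_one, one_mul]
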